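/- Riccati equation for the deviation Gram matrix: along any solution of the continuous-time EnKF flow with y = A u†, the symmetric J×J matrix E(t) with entries E(t)_{lj} = ⟨A e^{(l)}(t), A e^{(j)}(t)⟩_Γ satisfies the matrix differential equation dE/dt = −(2/J) E². -/

import Mathlib

open scoped BigOperators
open RealInnerProductSpace Matrix

noncomputable section

/-- The Γ-weighted inner product `⟨a,b⟩_Γ = ⟨Γ⁻¹ a, b⟩` on `ℝ^K`. -/
def gInner {K : ℕ} (Γ : Matrix (Fin K) (Fin K) ℝ)
    (a b : EuclideanSpace ℝ (Fin K)) : ℝ :=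
  ⟪Matrix.toEuclideanLin Γ⁻¹ a, b⟫

/-- Ensemble mean. -/
def ensMean {X : Type*} [AddCommGroup X] [Module ℝ X] {J : ℕ} (v : Fin J → X) : X :=
  (J : ℝ)⁻¹ • ∑ j, v j

/-- Right-hand side of the continuous-time EnKF flow. -/
def enkfRHS {X : Type*} [NormedAddCommGroup X] [InnerProductSpace ℝ X] {K J : ℕ}
    (A : X →L[ℝ] EuclideanSpace ℝ (Fin K)) (Γ : Matrix (Fin K) (Fin K) ℝ)
    (y : EuclideanSpace ℝ (Fin K)) (v : Fin J → X) (j : Fin J) : X :=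
  (J : ℝ)⁻¹ • ∑ k, gInner Γ (A (v k - ensMean v)) (y - A (v j)) • (v k - ensMean v)

/-- `u : ℝ → Fin J → X` solves the continuous-time EnKF flow on `[0,∞)`. -/
def IsEnKFSolution {X : Type*} [NormedAddCommGroup X] [InnerProductSpace ℝ X] {K J : ℕ}
    (A : X →L[ℝ] EuclideanSpace ℝ (Fin K)) (Γ : Matrix (Fin K) (Fin K) ℝ)
    (y : EuclideanSpace ℝ (Fin K)) (u : ℝ → Fin J → X) : Prop :=
  ∀ j : Fin J, ∀ t ∈ Set.Ici (0 : ℝ),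
    HasDerivWithinAt (fun s => u s j) (enkfRHS A Γ y (u t) j) (Set.Ici 0) t

/-- The deviation Gram matrix `E` of an ensemble. -/
def matE {X : Type*} [NormedAddCommGroup X] [InnerProductSpace ℝ X] {K J : ℕ}
    (A : X →L[ℝ] EuclideanSpace ℝ (Fin K)) (Γ : Matrix (Fin K) (Fin K) ℝ)
    (v : Fin J → X) : Matrix (Fin J) (Fin J) ℝ :=
  Matrix.of fun l j => gInner Γ (A (v l - ensMean v)) (A (v j - ensMean v))

/-- The residual/deviation cross Gram matrix `F` of an ensemble. -/
def matF {X : Type*} [NormedAddCommGroup X] [InnerProductSpace ℝ X] {K J : ℕ}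
    (A : X →L[ℝ] EuclideanSpace ℝ (Fin K)) (Γ : Matrix (Fin K) (Fin K) ℝ)
    (udag : X) (v : Fin J → X) : Matrix (Fin J) (Fin J) ℝ :=
  Matrix.of fun l j => gInner Γ (A (v l - udag)) (A (v j - ensMean v))

/-- The residual Gram matrix `R` of an ensemble. -/
def matR {X : Type*} [NormedAddCommGroup X] [InnerProductSpace ℝ X] {K J : ℕ}
    (A : X →L[ℝ] EuclideanSpace ℝ (Fin K)) (Γ : Matrix (Fin K) (Fin K) ℝ)
    (udag : X) (v : Fin J → X) : Matrix (Fin J) (Fin J) ℝ :=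
  Matrix.of fun l j => gInner Γ (A (v l - udag)) (A (v j - udag))

/-- The orthogonal complement of a subspace of `ℝ^K` w.r.t. the Γ-weighted inner product. -/
def gOrth {K : ℕ} (Γ : Matrix (Fin K) (Fin K) ℝ)
    (S : Submodule ℝ (EuclideanSpace ℝ (Fin K))) :
    Submodule ℝ (EuclideanSpace ℝ (Fin K)) where
  carrier := {w | ∀ v ∈ S, gInner Γ v w = 0}
  add_mem' := by
    intro a b ha hb v hv
    have h1 := ha v hv
    have h2 := hb v hv
    simp only [gInner, Set.mem_setOf_eq] at *
    rw [inner_add_right, h1, h2, add_zero]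
  zero_mem' := by
    intro v hv
    simp [gInner]
  smul_mem' := by
    intro c a ha v hv
    have h1 := ha v hv
    simp only [gInner, Set.mem_setOf_eq] at *
    rw [inner_smul_right, h1, mul_zero]

/-- The orthogonal complement of a subspace of `X` w.r.t. the inner product
`⟨v,w⟩_* = ⟨A v, A w⟩_Γ`. -/
def gOrthX {X : Type*} [NormedAddCommGroup X] [InnerProductSpace ℝ X] {K : ℕ}
    (A : X →L[ℝ] EuclideanSpace ℝ (Fin K)) (Γ : Matrix (Fin K) (Fin K) ℝ)
    (S : Submodule ℝ X) : Submodule ℝ X where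
  carrier := {w | ∀ v ∈ S, gInner Γ (A v) (A w) = 0}
  add_mem' := by
    intro a b ha hb v hv
    have h1 := ha v hv
    have h2 := hb v hv
    simp only [gInner, Set.mem_setOf_eq, map_add] at *
    rw [inner_add_right, h1, h2, add_zero]
  zero_mem' := by
    intro v hv
    simp [gInner]
  smul_mem' := by
    intro c a ha v hv
    have h1 := ha v hv
    simp only [gInner, Set.mem_setOf_eq, _root_.map_smul] at *
    rw [inner_smul_right, h1, mul_zero]


theorem gInner_symm' {K : ℕ} {Γ : Matrix (Fin K) (Fin K) ℝ} (hΓ : Γ.PosDef)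
    (a b : EuclideanSpace ℝ (Fin K)) : gInner Γ a b = gInner Γ b a := by
  have h : (Matrix.toEuclideanLin Γ⁻¹).IsSymmetric :=
    Matrix.isSymmetric_toEuclideanLin_iff.mpr hΓ.inv.isHermitian
  unfold gInner
  rw [h a b, real_inner_comm]

theorem ensMean_enkfRHS {X : Type*} [NormedAddCommGroup X] [InnerProductSpace ℝ X] {K J : ℕ}
    (hJ : 0 < J) (A : X →L[ℝ] EuclideanSpace ℝ (Fin K)) (Γ : Matrix (Fin K) (Fin K) ℝ)
    (y : EuclideanSpace ℝ (Fin K)) (v : Fin J → X) :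
    ensMean (enkfRHS A Γ y v) = (J : ℝ)⁻¹ •
      ∑ k, gInner Γ (A (v k - ensMean v)) (y - A (ensMean v)) • (v k - ensMean v) := by
  have hJ' : (J : ℝ) ≠ 0 := by positivity
  conv_lhs => unfold ensMean
  unfold enkfRHS
  rw [← Finset.smul_sum, Finset.sum_comm]
  congr 1
  rw [Finset.smul_sum]
  refine Finset.sum_congr rfl fun k _ => ?_
  rw [← Finset.sum_smul, smul_smul]
  congr 1
  generalize A (v k - ensMean v) = a
  simp only [gInner, ensMean, inner_sub_right, Finset.sum_sub_distrib, _root_.map_smul, map_sum,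
    inner_smul_right, inner_sum, Finset.sum_const, Finset.card_univ, Fintype.card_fin,
    nsmul_eq_mul]
  field_simp

theorem dev_enkfRHS {X : Type*} [NormedAddCommGroup X] [InnerProductSpace ℝ X] {K J : ℕ}
    (hJ : 0 < J) (A : X →L[ℝ] EuclideanSpace ℝ (Fin K)) (Γ : Matrix (Fin K) (Fin K) ℝ)
    (y : EuclideanSpace ℝ (Fin K)) (v : Fin J → X) (j : Fin J) :
    enkfRHS A Γ y v j - ensMean (enkfRHS A Γ y v) = -((J : ℝ)⁻¹ •
      ∑ k, matE A Γ v k j • (v k - ensMean v)) := by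
  rw [ensMean_enkfRHS hJ, enkfRHS, ← smul_sub, ← Finset.sum_sub_distrib, ← smul_neg,
    ← Finset.sum_neg_distrib]
  congr 1
  refine Finset.sum_congr rfl fun k _ => ?_
  rw [← sub_smul, ← neg_smul]
  congr 1
  simp only [matE, Matrix.of_apply, gInner, map_sub A (v j), inner_sub_right]
  ring

theorem enkf_gram_riccati
    {X : Type*} [NormedAddCommGroup X] [InnerProductSpace ℝ X]
    {K J : ℕ} (hJ : 0 < J)
    (A : X →L[ℝ] EuclideanSpace ℝ (Fin K))
    (Γ : Matrix (Fin K) (Fin K) ℝ) (hΓ : Γ.PosDef)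
    (udag : X) (u : ℝ → Fin J → X)
    (hu : IsEnKFSolution A Γ (A udag) u) :
    ∀ t ∈ Set.Ici (0 : ℝ), ∀ l j : Fin J,
      HasDerivWithinAt (fun s => matE A Γ (u s) l j)
        ((-(2 / (J : ℝ))) * (matE A Γ (u t) * matE A Γ (u t)) l j)
        (Set.Ici 0) t := by
  intro t ht l j
  have hd : ∀ i, HasDerivWithinAt (fun s => A (u s i - ensMean (u s)))
      (A (-((J : ℝ)⁻¹ • ∑ k, matE A Γ (u t) k i • (u t k - ensMean (u t))))) (Set.Ici 0) t := by
    intro i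
    rw [← dev_enkfRHS hJ A Γ (A udag) (u t) i]
    refine A.hasFDerivAt.comp_hasDerivWithinAt t ?_
    refine (hu i t ht).sub ?_
    exact (HasDerivWithinAt.fun_sum fun k _ => hu k t ht).const_smul ((J : ℝ)⁻¹)
  have hG := ((Matrix.toEuclideanLin Γ⁻¹).toContinuousLinearMap.hasFDerivAt.comp_hasDerivWithinAt
    t (hd l)).inner ℝ (hd j)
  have hsymm : ∀ a b, matE A Γ (u t) a b = matE A Γ (u t) b a := fun a b => gInner_symm' hΓ _ _
  refine hG.congr_deriv ?_
  have key : ∀ (i : Fin J) (w : EuclideanSpace ℝ (Fin K)), gInner Γ w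
      (A (-((J : ℝ)⁻¹ • ∑ k, matE A Γ (u t) k i • (u t k - ensMean (u t)))))
      = -((J : ℝ)⁻¹ * ∑ k, matE A Γ (u t) k i * gInner Γ w (A (u t k - ensMean (u t)))) := by
    intro i w
    simp only [gInner, map_neg, _root_.map_smul, map_sum, inner_neg_right, inner_smul_right,
      inner_sum]
  change gInner Γ (A (u t l - ensMean (u t))) _ + gInner Γ _ (A (u t j - ensMean (u t))) = _
  rw [gInner_symm' hΓ (A (-_)), key, key, Matrix.mul_apply]
  have e1 : ∑ k, matE A Γ (u t) k j * gInner Γ (A (u t l - ensMean (u t)))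
      (A (u t k - ensMean (u t))) = ∑ k, matE A Γ (u t) l k * matE A Γ (u t) k j :=
    Finset.sum_congr rfl fun k _ => mul_comm _ _
  have e2 : ∑ k, matE A Γ (u t) k l * gInner Γ (A (u t j - ensMean (u t)))
      (A (u t k - ensMean (u t))) = ∑ k, matE A Γ (u t) l k * matE A Γ (u t) k j := by
    refine Finset.sum_congr rfl fun k _ => ?_
    rw [hsymm l k, hsymm k j]
    rfl
  rw [e1, e2]
  ring

end
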